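/- Let p be a prime and n ≥ 1, k ≥ 1 integers. The reduction-mod-p^k ring homomorphism ZMod p^(k+1) → ZMod p^k induces a group homomorphism Sp(2n, ZMod p^(k+1)) → Sp(2n, ZMod p^k) (by applying the ring map entrywise), and this homomorphism is surjective. -/

import Mathlib

open Matrix

/-- The standard symplectic form matrix Ω = [[0, I], [-I, 0]]. -/
def Omega (m : ℕ) (R : Type*) [CommRing R] :
    Matrix (Fin m ⊕ Fin m) (Fin m ⊕ Fin m) R :=
  Matrix.fromBlocks 0 1 (-1) 0

/-- The symplectic group `Sp(2m, R)`: matrices `M` with `Mᵀ * Ω * M = Ω`,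
as a subgroup of the general linear group. -/
def Sp (m : ℕ) (R : Type*) [CommRing R] : Subgroup (GL (Fin m ⊕ Fin m) R) where
  carrier := {M | (M.val)ᵀ * Omega m R * M.val = Omega m R}
  one_mem' := by simp
  mul_mem' := by
    intro a b ha hb
    simp only [Set.mem_setOf_eq, Units.val_mul, Matrix.transpose_mul] at ha hb ⊢
    calc (b.val)ᵀ * (a.val)ᵀ * Omega m R * (a.val * b.val)
        = (b.val)ᵀ * ((a.val)ᵀ * Omega m R * a.val * b.val) := by
          simp only [Matrix.mul_assoc]
      _ = Omega m R := by rw [ha, ← Matrix.mul_assoc]; exact hb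
  inv_mem' := by
    intro a ha
    simp only [Set.mem_setOf_eq] at ha ⊢
    have h1 : a.val * (a⁻¹).val = 1 := by
      rw [← Units.val_mul, mul_inv_cancel, Units.val_one]
    calc ((a⁻¹).val)ᵀ * Omega m R * (a⁻¹).val
        = ((a⁻¹).val)ᵀ * ((a.val)ᵀ * Omega m R * a.val) * (a⁻¹).val := by rw [ha]
      _ = (a.val * (a⁻¹).val)ᵀ * Omega m R * (a.val * (a⁻¹).val) := by
          simp only [Matrix.transpose_mul, Matrix.mul_assoc]
      _ = Omega m R := by rw [h1]; simp


variable {R S : Type*} [CommRing R] [CommRing S]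

lemma Omega_map (n : ℕ) (f : R →+* S) : (Omega n R).map f = Omega n S := by
  have h1 : ((-1 : Matrix (Fin n) (Fin n) R)).map f = -1 := by
    ext i j
    simp [Matrix.one_apply, apply_ite f]
  simp [Omega, Matrix.fromBlocks_map, Matrix.map_zero _ (map_zero f),
    Matrix.map_one _ (map_zero f) (map_one f), h1]

lemma map_mem_Sp (n : ℕ) (f : R →+* S) {M : GL (Fin n ⊕ Fin n) R} (hM : M ∈ Sp n R) :
    Matrix.GeneralLinearGroup.map f M ∈ Sp n S := by
  have hcoe : (Matrix.GeneralLinearGroup.map f M).val = M.val.map f := rfl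
  show (Matrix.GeneralLinearGroup.map f M).val ᵀ * Omega n S * (Matrix.GeneralLinearGroup.map f M).val = Omega n S
  rw [hcoe, ← Matrix.transpose_map, ← Omega_map n f, ← Matrix.map_mul, ← Matrix.map_mul]
  rw [show M.valᵀ * Omega n R * M.val = Omega n R from hM]

/-- The reduction homomorphism between symplectic groups induced by a ring map. -/
def spHom (n : ℕ) (f : R →+* S) : Sp n R →* Sp n S :=
  ((Matrix.GeneralLinearGroup.map f).comp (Sp n R).subtype).codRestrict (Sp n S)
    (fun M => map_mem_Sp n f M.property)

lemma Omega_transpose (n : ℕ) (R : Type*) [CommRing R] : (Omega n R)ᵀ = -Omega n R := by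
  simp [Omega, Matrix.fromBlocks_transpose, Matrix.fromBlocks_neg]

lemma Omega_mul_self (n : ℕ) (R : Type*) [CommRing R] : Omega n R * Omega n R = -1 := by
  rw [Omega, Matrix.fromBlocks_multiply, ← Matrix.fromBlocks_one, Matrix.fromBlocks_neg]
  simp

lemma exists_Omega_eq_sub_transpose (n : ℕ) (R : Type*) [CommRing R] :
    ∃ P : Matrix (Fin n ⊕ Fin n) (Fin n ⊕ Fin n) R, Omega n R = P - Pᵀ := by
  refine ⟨Matrix.fromBlocks 0 1 0 0, ?_⟩
  simp [Omega, Matrix.fromBlocks_transpose, sub_eq_add_neg, Matrix.fromBlocks_neg,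
    Matrix.fromBlocks_add]

/-- A symplectic matrix is invertible. -/
lemma exists_mem_Sp_of_transpose_mul_Omega_mul {n : ℕ}
    {N : Matrix (Fin n ⊕ Fin n) (Fin n ⊕ Fin n) R} (hN : Nᵀ * Omega n R * N = Omega n R) :
    ∃ M ∈ Sp n R, M.val = N := by
  have hl : (-Omega n R * Nᵀ * Omega n R) * N = 1 := by
    rw [Matrix.mul_assoc, Matrix.mul_assoc, ← Matrix.mul_assoc Nᵀ, hN, Matrix.neg_mul,
      Omega_mul_self, neg_neg]
  exact ⟨⟨N, -Omega n R * Nᵀ * Omega n R, mul_eq_one_comm.mp hl, hl⟩, hN, rfl⟩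

/-- An alternating matrix over a ring which vanishes under `f` is of the form `F - Fᵀ` for some
matrix `F` which vanishes under `f`. -/
lemma exists_eq_sub_transpose_of_map_eq_zero {ι : Type*} [LinearOrder ι] (f : R →+* S)
    {E : Matrix ι ι R} (hE : Eᵀ = -E) (hdiag : ∀ i, E i i = 0) (hf : E.map f = 0) :
    ∃ F : Matrix ι ι R, F.map f = 0 ∧ E = F - Fᵀ := by
  refine ⟨Matrix.of fun i j => if i < j then E i j else 0, ?_, ?_⟩
  · ext i j
    have h : f (E i j) = 0 := congr_fun₂ hf i j
    simp only [Matrix.map_apply, Matrix.of_apply, Matrix.zero_apply]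
    split_ifs <;> simp [h]
  · ext i j
    have h : E j i = -E i j := congr_fun₂ hE i j
    rcases lt_trichotomy i j with hij | rfl | hij
    · simp [hij, hij.not_gt]
    · simp [hdiag]
    · simp [hij, hij.not_gt, h]

lemma mul_eq_zero_of_map_eq_zero {ι : Type*} [Fintype ι] {f : R →+* S}
    (hf : ∀ a b, f a = 0 → f b = 0 → a * b = 0) {A B : Matrix ι ι R}
    (hA : A.map f = 0) (hB : B.map f = 0) : A * B = 0 := by
  ext i j
  rw [Matrix.mul_apply]
  exact Finset.sum_eq_zero fun l _ => hf _ _ (congr_fun₂ hA i l) (congr_fun₂ hB l j)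

/-- Symplectic matrices lift along surjective ring maps with square-zero kernel. -/
theorem spHom_surjective_of_ker_mul_ker (n : ℕ) (f : R →+* S) (hsurj : Function.Surjective f)
    (hf : ∀ a b, f a = 0 → f b = 0 → a * b = 0) : Function.Surjective (spHom n f) := by
  rintro ⟨M, hM⟩
  change M.valᵀ * Omega n S * M.val = Omega n S at hM
  choose g hg using hsurj
  set N : Matrix (Fin n ⊕ Fin n) (Fin n ⊕ Fin n) R := M.val.map g
  have hN : N.map f = M.val := by
    ext i j
    exact hg _
  set E := Nᵀ * Omega n R * N - Omega n R with hE
  have hEmap : E.map f = 0 := by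
    rw [hE, Matrix.map_sub f (map_sub f), Matrix.map_mul, Matrix.map_mul, Matrix.transpose_map,
      Omega_map, hN, hM, sub_self]
  have hEskew : Eᵀ = -E := by
    simp only [hE, Matrix.transpose_sub, Matrix.transpose_mul, Matrix.transpose_transpose,
      Omega_transpose, Matrix.mul_assoc, Matrix.neg_mul, Matrix.mul_neg]
    abel
  have hEdiag : ∀ i, E i i = 0 := by
    obtain ⟨P, hP⟩ := exists_Omega_eq_sub_transpose n R
    have hEP : E = (Nᵀ * P * N - P) - (Nᵀ * P * N - P)ᵀ := by
      simp only [hE, hP, Matrix.transpose_sub, Matrix.transpose_mul, Matrix.transpose_transpose,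
        Matrix.mul_assoc, Matrix.mul_sub, Matrix.sub_mul]
      abel
    intro i
    rw [hEP, Matrix.sub_apply, Matrix.transpose_apply, sub_self]
  let _ : LinearOrder (Fin n ⊕ Fin n) := LinearOrder.lift' toLex toLex.injective
  obtain ⟨F, hFmap, hF⟩ := exists_eq_sub_transpose_of_map_eq_zero f hEskew hEdiag hEmap
  set X := Omega n R * F with hX
  have hXmap : X.map f = 0 := by rw [hX, Matrix.map_mul, hFmap, Matrix.mul_zero]
  have hXtmap : Xᵀ.map f = 0 := by rw [Matrix.transpose_map, hXmap, Matrix.transpose_zero]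
  have hOX : Omega n R * X = -F := by
    rw [hX, ← Matrix.mul_assoc, Omega_mul_self, Matrix.neg_mul, Matrix.one_mul]
  have hXO : Xᵀ * Omega n R = Fᵀ := by
    rw [hX, Matrix.transpose_mul, Matrix.mul_assoc, Omega_transpose, Matrix.neg_mul,
      Omega_mul_self, neg_neg, Matrix.mul_one]
  have hXE : Xᵀ * E = 0 := mul_eq_zero_of_map_eq_zero hf hXtmap hEmap
  have hEX : E * X = 0 := mul_eq_zero_of_map_eq_zero hf hEmap hXmap
  have hFX : Fᵀ * X = 0 := mul_eq_zero_of_map_eq_zero hf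
    (by rw [Matrix.transpose_map, hFmap, Matrix.transpose_zero]) hXmap
  have hlift : (N * (1 + X))ᵀ * Omega n R * (N * (1 + X)) = Omega n R := by
    calc (N * (1 + X))ᵀ * Omega n R * (N * (1 + X))
        = (1 + Xᵀ) * (Nᵀ * Omega n R * N) * (1 + X) := by
          simp only [Matrix.transpose_mul, Matrix.transpose_add, Matrix.transpose_one,
            Matrix.mul_assoc]
      _ = (1 + Xᵀ) * (Omega n R + E) * (1 + X) := by rw [hE, add_sub_cancel]
      _ = Omega n R + E + Xᵀ * Omega n R + Omega n R * X + Xᵀ * Omega n R * X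
            + Xᵀ * E + E * X + Xᵀ * E * X := by noncomm_ring
      _ = Omega n R := by
          rw [hXE, hEX, hXO, hFX, hOX, hF, Matrix.zero_mul]
          abel
  obtain ⟨L, hL, hLval⟩ := exists_mem_Sp_of_transpose_mul_Omega_mul hlift
  refine ⟨⟨L, hL⟩, Subtype.ext (Units.ext ?_)⟩
  change L.val.map f = M.val
  rw [hLval, Matrix.map_mul, hN, Matrix.map_add f (map_add f), hXmap, add_zero,
    Matrix.map_one f (map_zero f) (map_one f), Matrix.mul_one]

/-- The kernel of the reduction `ZMod (p ^ (k + 1)) → ZMod (p ^ k)` squares to zero. -/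
lemma mul_eq_zero_of_castHom_pow_eq_zero {p k : ℕ} (hp : p ≠ 0) (hk : 1 ≤ k)
    (a b : ZMod (p ^ (k + 1)))
    (ha : ZMod.castHom (pow_dvd_pow p k.le_succ) (ZMod (p ^ k)) a = 0)
    (hb : ZMod.castHom (pow_dvd_pow p k.le_succ) (ZMod (p ^ k)) b = 0) : a * b = 0 := by
  have : NeZero p := ⟨hp⟩
  obtain ⟨a, rfl⟩ := ZMod.natCast_zmod_surjective a
  obtain ⟨b, rfl⟩ := ZMod.natCast_zmod_surjective b
  rw [map_natCast, ZMod.natCast_eq_zero_iff] at ha hb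
  rw [← Nat.cast_mul, ZMod.natCast_eq_zero_iff]
  calc p ^ (k + 1) ∣ p ^ (k + k) := pow_dvd_pow p (by lia)
    _ = p ^ k * p ^ k := pow_add p k k
    _ ∣ a * b := mul_dvd_mul ha hb

/-- **Surjectivity of reduction.** The group homomorphism
`Sp(2n, ℤ/p^(k+1)ℤ) → Sp(2n, ℤ/p^kℤ)` obtained by applying the canonical ring map
`ZMod (p^(k+1)) → ZMod (p^k)` to each matrix entry is surjective. -/
theorem spHom_reduction_surjective (p : ℕ) (hp : p.Prime) (n k : ℕ) (hn : 1 ≤ n) (hk : 1 ≤ k) :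
    Function.Surjective
      (spHom n (ZMod.castHom (pow_dvd_pow p k.le_succ) (ZMod (p ^ k)))) := by
  exact spHom_surjective_of_ker_mul_ker n _ (ZMod.castHom_surjective _)
    (mul_eq_zero_of_castHom_pow_eq_zero hp.ne_zero hk)
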